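/- Assume q ≥ m and let α ∈ Z^m. Then: (1) α ∈ Ĥ(Q) if and only if ℓ(D_α) = ℓ(D_α − Q_i) + 1 for all i ∈ {1, ..., m}; (2) for each i ∈ {1, ..., m}, ∇_i^m(α) = ∅ if and only if ℓ(D_α) = ℓ(D_α − Q_i). -/

import Mathlib

open scoped Classical

/-- Abstract divisor-theoretic data of a nonsingular, projective, geometrically
irreducible algebraic curve over a field `Fq`: a function field `K`, a set of
closed points with their degrees, a genus, and the normalized discrete
valuations of `K` at the closed points (with the junk convention `v P 0 = 0`). -/
structure Curve (Fq : Type) [Field Fq] where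
  /-- the function field of the curve -/
  K : Type
  [fieldK : Field K]
  [algebraK : Algebra Fq K]
  /-- the closed points of the curve -/
  Point : Type
  /-- the degree of a closed point -/
  deg : Point → ℕ
  deg_pos : ∀ P, 0 < deg P
  /-- the genus of the curve -/
  genus : ℕ
  /-- the normalized discrete valuation at a closed point -/
  v : Point → K → ℤ
  v_zero : ∀ P, v P 0 = 0
  v_mul : ∀ (P : Point) {x y : K}, x ≠ 0 → y ≠ 0 → v P (x * y) = v P x + v P y
  v_min_le_add : ∀ (P : Point) {x y : K}, x ≠ 0 → y ≠ 0 → x + y ≠ 0 →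
    min (v P x) (v P y) ≤ v P (x + y)
  v_algebraMap : ∀ (P : Point) (c : Fq), c ≠ 0 → v P (algebraMap Fq K c) = 0
  v_surjective : ∀ P : Point, ∃ x : K, x ≠ 0 ∧ v P x = 1
  /-- a nonzero function has only finitely many zeros and poles -/
  support_finite : ∀ {x : K}, x ≠ 0 → {P : Point | v P x ≠ 0}.Finite
  /-- a function without poles is constant (the curve is projective and
  geometrically irreducible) -/
  no_pole_constant : ∀ {x : K}, x ≠ 0 → (∀ P, 0 ≤ v P x) → ∃ c : Fq, x = algebraMap Fq K c
  /-- principal divisors have degree zero -/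
  degree_principal : ∀ {x : K}, x ≠ 0 → ∑ᶠ P : Point, (deg P : ℤ) * v P x = 0

attribute [instance] Curve.fieldK Curve.algebraK

namespace Curve

variable {Fq : Type} [Field Fq] [Fintype Fq]

/-- The degree of a divisor. -/
noncomputable def degDiv (C : Curve Fq) (D : C.Point →₀ ℤ) : ℤ :=
  D.sum fun P n => (C.deg P : ℤ) * n

/-- The Riemann–Roch space `L(D)`. -/
def Lset (C : Curve Fq) (D : C.Point →₀ ℤ) : Set C.K :=
  {h | h = 0 ∨ ∀ P : C.Point, 0 ≤ C.v P h + D P}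

/-- `ℓ(D)`, the dimension of `L(D)` as an `Fq`-vector space. -/
noncomputable def ell (C : Curve Fq) (D : C.Point →₀ ℤ) : ℕ :=
  Module.finrank Fq (Submodule.span Fq (C.Lset D))

/-- The divisor `D` is principal. -/
def IsPrincipalDiv (C : Curve Fq) (D : C.Point →₀ ℤ) : Prop :=
  ∃ h : C.K, h ≠ 0 ∧ ∀ P : C.Point, C.v P h = D P

/-- The divisor `D_α = α₁Q₁ + ⋯ + α_mQ_m`. -/
noncomputable def Dt (C : Curve Fq) {m : ℕ} (Q : Fin m → C.Point) (α : Fin m → ℤ) :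
    C.Point →₀ ℤ :=
  ∑ i, Finsupp.single (Q i) (α i)

/-- The generalized Weierstrass semigroup `Ĥ(Q)`: the set of tuples
`(-v_{Q_1}(h), …, -v_{Q_m}(h))` for nonzero `h` having poles only in `{Q_1, …, Q_m}`. -/
def Hhat (C : Curve Fq) {m : ℕ} (Q : Fin m → C.Point) : Set (Fin m → ℤ) :=
  {α | ∃ h : C.K, h ≠ 0 ∧ (∀ P : C.Point, P ∉ Set.range Q → 0 ≤ C.v P h) ∧
    ∀ i, α i = -C.v (Q i) h}

/-- `∇_J(α)`. -/
def nabla (C : Curve Fq) {m : ℕ} (Q : Fin m → C.Point) (J : Set (Fin m))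
    (α : Fin m → ℤ) : Set (Fin m → ℤ) :=
  {β | β ∈ C.Hhat Q ∧ (∀ j ∈ J, β j = α j) ∧ ∀ i ∉ J, β i < α i}

/-- `∇_i^m(α)`. -/
def nablaI (C : Curve Fq) {m : ℕ} (Q : Fin m → C.Point) (i : Fin m) (α : Fin m → ℤ) :
    Set (Fin m → ℤ) :=
  {β | β ∈ C.Hhat Q ∧ β i = α i ∧ ∀ j, j ≠ i → β j ≤ α j}

/-- `Γ̂(Q)`, the set of absolute maximal elements of `Ĥ(Q)`. -/
def Gammahat (C : Curve Fq) {m : ℕ} (Q : Fin m → C.Point) : Set (Fin m → ℤ) :=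
  {α | α ∈ C.Hhat Q ∧
    ∀ J : Set (Fin m), J.Nonempty → J ≠ Set.univ → C.nabla Q J α = ∅}

/-- `Γ̂_Q(α) = {β ∈ Γ̂(Q) : β ≤ α}`. -/
def GammahatLe (C : Curve Fq) {m : ℕ} (Q : Fin m → C.Point) (α : Fin m → ℤ) :
    Set (Fin m → ℤ) :=
  {β | β ∈ C.Gammahat Q ∧ ∀ i, β i ≤ α i}

/-- The divisor `A` is a discrepancy with respect to `P` and `Q'`. -/
def IsDiscrepancy (C : Curve Fq) (A : C.Point →₀ ℤ) (P Q' : C.Point) : Prop :=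
  C.Lset A ≠ C.Lset (A - Finsupp.single Q' 1) ∧
  C.Lset (A - Finsupp.single P 1) = C.Lset (A - Finsupp.single P 1 - Finsupp.single Q' 1)

/-- `T_α = {β ∈ ℤ^m : β ≤ α and ℓ(D_β) = ℓ(D_α)}`. -/
def Tset (C : Curve Fq) {m : ℕ} (Q : Fin m → C.Point) (α : Fin m → ℤ) :
    Set (Fin m → ℤ) :=
  {β | (∀ j, β j ≤ α j) ∧ C.ell (C.Dt Q β) = C.ell (C.Dt Q α)}

/-- `D_β` is the supported floor `⌊D_α⌋_Q`: `β` is the element of `T_α` of minimum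
norm `|β| = β₁ + ⋯ + β_m`. -/
def IsSuppFloor (C : Curve Fq) {m : ℕ} (Q : Fin m → C.Point) (α β : Fin m → ℤ) : Prop :=
  β ∈ C.Tset Q α ∧ ∀ γ ∈ C.Tset Q α, ∑ i, β i ≤ ∑ i, γ i

/-- `G'` is the floor `⌊G⌋` of `G`: among all divisors with the same Riemann–Roch
space as `G`, it has minimum degree. -/
def IsFloorDiv (C : Curve Fq) (G G' : C.Point →₀ ℤ) : Prop :=
  C.Lset G' = C.Lset G ∧
  ∀ G'' : C.Point →₀ ℤ, C.Lset G'' = C.Lset G → C.degDiv G' ≤ C.degDiv G''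

end Curve

/-- A vector space over `F_q` is not the union of at most `q` proper subspaces. -/
theorem Submodule.exists_mem_forall_notMem_of_card_le {k V ι : Type*} [Field k] [Fintype k]
    [AddCommGroup V] [Module k V] [Fintype ι] {W : Submodule k V} [FiniteDimensional k W]
    {p : ι → Submodule k V} (hp : ∀ i, p i < W) (hι : Fintype.card ι ≤ Fintype.card k) :
    ∃ x ∈ W, ∀ i, x ∉ p i := by
  by_contra! hcover
  have hfin : Finite W := Module.finite_of_finite k
  have hWfin : (W : Set V).Finite := Set.toFinite _
  have hsub : (W : Set V) \ {0} ⊆ ⋃ i, (p i : Set V) \ {0} := by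
    rintro x ⟨hx, hx0⟩
    obtain ⟨i, hi⟩ := hcover x hx
    exact Set.mem_iUnion.2 ⟨i, hi, hx0⟩
  have hpfin (i : ι) : (p i : Set V).Finite := hWfin.subset (hp i).le
  have hunion : ((W : Set V) \ {0}).ncard ≤ ∑ i, ((p i : Set V) \ {0}).ncard :=
    (Set.ncard_le_ncard hsub (Set.finite_iUnion fun i => (hpfin i).sdiff)).trans
      (Set.ncard_iUnion_le_of_fintype _)
  have hpcard (i : ι) : ((p i : Set V) \ {0}).ncard + 1 = (p i : Set V).ncard :=
    Set.ncard_sdiff_singleton_add_one (zero_mem (p i)) (hpfin i)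
  have hWcard : ((W : Set V) \ {0}).ncard + 1 = (W : Set V).ncard :=
    Set.ncard_sdiff_singleton_add_one (zero_mem W) hWfin
  have hpow (i : ι) : Fintype.card k * (p i : Set V).ncard ≤ (W : Set V).ncard := by
    have := Submodule.finiteDimensional_of_le (hp i).le
    have hlt := Submodule.finrank_lt_finrank_of_lt (hp i)
    change _ * Nat.card (p i) ≤ Nat.card W
    rw [Module.natCard_eq_pow_finrank (K := k) (V := p i),
      Module.natCard_eq_pow_finrank (K := k) (V := W), Nat.card_eq_fintype_card, ← pow_succ']
    exact Nat.pow_le_pow_right Fintype.card_pos hlt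
  have hbound : Fintype.card k * ∑ i, ((p i : Set V) \ {0}).ncard ≤
      Fintype.card ι * ((W : Set V).ncard - Fintype.card k) := by
    rw [Finset.mul_sum, ← smul_eq_mul (Fintype.card ι), ← Finset.card_univ (α := ι)]
    refine Finset.sum_le_card_nsmul _ _ _ fun i _ => Nat.le_sub_of_add_le ?_
    simpa only [← hpcard i, mul_add_one] using hpow i
  have hk : 1 < Fintype.card k := Fintype.one_lt_card
  have hle : ((W : Set V) \ {0}).ncard ≤ (W : Set V).ncard - Fintype.card k :=
    Nat.le_of_mul_le_mul_left ((Nat.mul_le_mul_left _ hunion).trans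
      (hbound.trans (Nat.mul_le_mul_right _ hι))) (by omega)
  obtain ⟨i, -⟩ := hcover 0 (zero_mem W)
  have hge : Fintype.card k ≤ (W : Set V).ncard :=
    (Nat.le_mul_of_pos_right _ (by have := hpcard i; omega)).trans (hpow i)
  omega

namespace Curve

variable {Fq : Type} [Field Fq] (C : Curve Fq)

theorem v_add_nonneg (P : C.Point) {x y : C.K} {n : ℤ} (hx : x = 0 ∨ 0 ≤ C.v P x + n)
    (hy : y = 0 ∨ 0 ≤ C.v P y + n) (hxy : x + y ≠ 0) : 0 ≤ C.v P (x + y) + n := by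
  rcases eq_or_ne x 0 with rfl | hx0
  · simp_all
  rcases eq_or_ne y 0 with rfl | hy0
  · simp_all
  have := C.v_min_le_add P hx0 hy0 hxy
  simp only [hx0, hy0, false_or] at hx hy
  omega

/-- `L(D)` as an `Fq`-subspace of the function field. -/
def riemannRochSpace (D : C.Point →₀ ℤ) : Submodule Fq C.K where
  carrier := C.Lset D
  zero_mem' := Or.inl rfl
  add_mem' := by
    intro x y hx hy
    by_cases hxy : x + y = 0
    · exact Or.inl hxy
    · exact Or.inr fun P => C.v_add_nonneg P (hx.imp_right (· P)) (hy.imp_right (· P)) hxy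
  smul_mem' := by
    rintro c x (rfl | hx)
    · exact Or.inl (smul_zero c)
    rcases eq_or_ne c 0 with rfl | hc
    · exact Or.inl (zero_smul Fq x)
    rcases eq_or_ne x 0 with rfl | hx0
    · exact Or.inl (smul_zero c)
    refine Or.inr fun P => ?_
    have hc' : algebraMap Fq C.K c ≠ 0 := by simpa using hc
    rw [Algebra.smul_def, C.v_mul P hc' hx0, C.v_algebraMap P c hc, zero_add]
    exact hx P

theorem mem_riemannRochSpace {D : C.Point →₀ ℤ} {h : C.K} :
    h ∈ C.riemannRochSpace D ↔ h = 0 ∨ ∀ P, 0 ≤ C.v P h + D P :=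
  Iff.rfl

theorem ell_eq_finrank (D : C.Point →₀ ℤ) :
    C.ell D = Module.finrank Fq (C.riemannRochSpace D) := by
  rw [ell, show C.Lset D = C.riemannRochSpace D from rfl, Submodule.span_eq]

theorem riemannRochSpace_mono : Monotone C.riemannRochSpace := by
  intro D E hDE h hh
  exact hh.imp_right fun hh P => (hh P).trans (by have := hDE P; omega)

theorem degDiv_add (D E : C.Point →₀ ℤ) : C.degDiv (D + E) = C.degDiv D + C.degDiv E :=
  Finsupp.sum_add_index' (fun _ => mul_zero _) fun _ _ _ => mul_add _ _ _

theorem degDiv_single (P : C.Point) (n : ℤ) :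
    C.degDiv (Finsupp.single P n) = C.deg P * n :=
  Finsupp.sum_single_index (mul_zero _)

theorem degDiv_sub (D E : C.Point →₀ ℤ) : C.degDiv (D - E) = C.degDiv D - C.degDiv E := by
  rw [eq_sub_iff_add_eq, ← degDiv_add, sub_add_cancel]

theorem riemannRochSpace_eq_bot {D : C.Point →₀ ℤ} (hD : C.degDiv D < 0) :
    C.riemannRochSpace D = ⊥ := by
  refine (Submodule.eq_bot_iff _).2 fun h hh => ?_
  by_contra hh0
  have hpos := (C.mem_riemannRochSpace.1 hh).resolve_left hh0
  set S := (C.support_finite hh0).toFinset ∪ D.support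
  have hdeg : C.degDiv D = ∑ P ∈ S, (C.deg P : ℤ) * D P :=
    Finsupp.sum_of_support_subset _ Finset.subset_union_right _ fun _ _ => mul_zero _
  have hprinc : ∑ P ∈ S, (C.deg P : ℤ) * C.v P h = 0 := by
    rw [← C.degree_principal hh0, finsum_eq_sum_of_support_subset]
    intro P hP
    simp_all [S]
  have hsum : 0 ≤ ∑ P ∈ S, (C.deg P : ℤ) * (C.v P h + D P) :=
    Finset.sum_nonneg fun P _ => mul_nonneg (by positivity) (hpos P)
  simp only [mul_add, Finset.sum_add_distrib, hprinc, ← hdeg] at hsum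
  omega

theorem ell_eq_zero_of_degDiv_neg {D : C.Point →₀ ℤ} (hD : C.degDiv D < 0) : C.ell D = 0 := by
  rw [ell_eq_finrank, C.riemannRochSpace_eq_bot hD, finrank_bot]

section RiemannRoch

variable {C} {K₀ : C.Point →₀ ℤ}

/-- An infinite-dimensional `L(D)` would have junk dimension `0`, and so would `L(E)` for every
`E ≥ D`; this contradicts the Riemann–Roch formula for `E` of large degree. -/
theorem finiteDimensional_riemannRochSpace
    (hRR : ∀ D : C.Point →₀ ℤ, (C.ell D : ℤ) - C.ell (K₀ - D) = C.degDiv D + 1 - C.genus)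
    (P : C.Point) (D : C.Point →₀ ℤ) : FiniteDimensional Fq (C.riemannRochSpace D) := by
  by_contra hD
  obtain ⟨n, hn0, hn, hn'⟩ : ∃ n : ℤ, 0 ≤ n ∧ C.genus - C.degDiv D ≤ n ∧
      C.degDiv K₀ - C.degDiv D < n :=
    ⟨max 0 (max (C.genus - C.degDiv D) (C.degDiv K₀ - C.degDiv D + 1)), by omega, by omega,
      by omega⟩
  have hle : D ≤ D + Finsupp.single P n := le_add_of_nonneg_right (Finsupp.single_nonneg.2 hn0)
  have hdeg : C.degDiv D + n ≤ C.degDiv (D + Finsupp.single P n) := by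
    rw [degDiv_add, degDiv_single]
    have : (1 : ℤ) ≤ C.deg P := by exact_mod_cast C.deg_pos P
    nlinarith
  have hzero : C.ell (D + Finsupp.single P n) = 0 := by
    rw [ell_eq_finrank]
    refine Module.finrank_of_not_finite fun hfin => hD ?_
    exact Submodule.finiteDimensional_of_le (C.riemannRochSpace_mono hle)
  have hneg : C.ell (K₀ - (D + Finsupp.single P n)) = 0 :=
    C.ell_eq_zero_of_degDiv_neg (by rw [degDiv_sub]; omega)
  have := hRR (D + Finsupp.single P n)
  omega

theorem ell_mono
    (hRR : ∀ D : C.Point →₀ ℤ, (C.ell D : ℤ) - C.ell (K₀ - D) = C.degDiv D + 1 - C.genus)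
    (P : C.Point) : Monotone C.ell := by
  intro D E hDE
  have := finiteDimensional_riemannRochSpace hRR P E
  simpa only [ell_eq_finrank] using Submodule.finrank_mono (C.riemannRochSpace_mono hDE)

theorem ell_le_ell_sub_single_add_one
    (hRR : ∀ D : C.Point →₀ ℤ, (C.ell D : ℤ) - C.ell (K₀ - D) = C.degDiv D + 1 - C.genus)
    {P : C.Point} (hP : C.deg P = 1) (D : C.Point →₀ ℤ) :
    C.ell D ≤ C.ell (D - Finsupp.single P 1) + 1 := by
  have hsingle : (0 : C.Point →₀ ℤ) ≤ Finsupp.single P 1 := Finsupp.single_nonneg.2 zero_le_one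
  have hmono : C.ell (K₀ - D) ≤ C.ell (K₀ - (D - Finsupp.single P 1)) :=
    ell_mono hRR P (sub_le_sub_left (sub_le_self D hsingle) K₀)
  have h₁ := hRR D
  have h₂ := hRR (D - Finsupp.single P 1)
  rw [degDiv_sub, degDiv_single, hP] at h₂
  push_cast at h₂
  omega

theorem ell_eq_ell_sub_single_iff
    (hRR : ∀ D : C.Point →₀ ℤ, (C.ell D : ℤ) - C.ell (K₀ - D) = C.degDiv D + 1 - C.genus)
    (P : C.Point) (D : C.Point →₀ ℤ) :
    C.ell D = C.ell (D - Finsupp.single P 1) ↔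
      C.riemannRochSpace D ≤ C.riemannRochSpace (D - Finsupp.single P 1) := by
  have := finiteDimensional_riemannRochSpace hRR P D
  have hle : C.riemannRochSpace (D - Finsupp.single P 1) ≤ C.riemannRochSpace D :=
    C.riemannRochSpace_mono (sub_le_self D (Finsupp.single_nonneg.2 zero_le_one))
  simp only [ell_eq_finrank]
  constructor
  · exact fun h => (Submodule.eq_of_le_of_finrank_eq hle h.symm).ge
  · exact fun h => congrArg (fun W : Submodule Fq C.K => Module.finrank Fq W) (h.antisymm hle)

theorem ell_eq_ell_sub_single_add_one_iff
    (hRR : ∀ D : C.Point →₀ ℤ, (C.ell D : ℤ) - C.ell (K₀ - D) = C.degDiv D + 1 - C.genus)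
    {P : C.Point} (hP : C.deg P = 1) (D : C.Point →₀ ℤ) :
    C.ell D = C.ell (D - Finsupp.single P 1) + 1 ↔
      ¬ C.riemannRochSpace D ≤ C.riemannRochSpace (D - Finsupp.single P 1) := by
  rw [← ell_eq_ell_sub_single_iff hRR]
  have h₁ := ell_le_ell_sub_single_add_one hRR hP D
  have h₂ : C.ell (D - Finsupp.single P 1) ≤ C.ell D :=
    ell_mono hRR P (sub_le_self D (Finsupp.single_nonneg.2 zero_le_one))
  omega

end RiemannRoch

theorem mem_riemannRochSpace_sub_single_iff {D : C.Point →₀ ℤ} {P : C.Point} {h : C.K}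
    (hh : h ∈ C.riemannRochSpace D) (hh0 : h ≠ 0) :
    h ∈ C.riemannRochSpace (D - Finsupp.single P 1) ↔ D P ≠ -C.v P h := by
  simp only [mem_riemannRochSpace, hh0, false_or, Finsupp.sub_apply] at hh ⊢
  constructor
  · intro hP
    have := hP P
    rw [Finsupp.single_eq_same] at this
    omega
  · intro hne R
    have hR := hh R
    rcases eq_or_ne R P with rfl | hRP
    · rw [Finsupp.single_eq_same]
      omega
    · rw [Finsupp.single_eq_of_ne hRP]
      omega

section Dt

variable {m : ℕ} {Q : Fin m → C.Point} (α : Fin m → ℤ)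

theorem Dt_apply (hQ : Function.Injective Q) (i : Fin m) : C.Dt Q α (Q i) = α i := by
  simp [Dt, Finsupp.finsetSum_apply, Finsupp.single_apply, hQ.eq_iff]

theorem Dt_apply_of_notMem_range {P : C.Point} (hP : P ∉ Set.range Q) : C.Dt Q α P = 0 := by
  rw [Dt, Finsupp.finsetSum_apply]
  exact Finset.sum_eq_zero fun i _ => Finsupp.single_eq_of_ne fun h => hP ⟨i, h.symm⟩

theorem mem_riemannRochSpace_Dt_iff (hQ : Function.Injective Q) {h : C.K} (hh0 : h ≠ 0) :
    h ∈ C.riemannRochSpace (C.Dt Q α) ↔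
      (∀ P, P ∉ Set.range Q → 0 ≤ C.v P h) ∧ ∀ i, -C.v (Q i) h ≤ α i := by
  simp only [mem_riemannRochSpace, hh0, false_or]
  constructor
  · intro hh
    refine ⟨fun P hP => ?_, fun i => ?_⟩
    · simpa [C.Dt_apply_of_notMem_range α hP] using hh P
    · have := hh (Q i)
      rw [C.Dt_apply α hQ] at this
      omega
  · rintro ⟨hout, hin⟩ P
    by_cases hP : P ∈ Set.range Q
    · obtain ⟨i, rfl⟩ := hP
      have := hin i
      rw [C.Dt_apply α hQ]
      omega
    · simpa [C.Dt_apply_of_notMem_range α hP] using hout P hP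

theorem mem_Hhat_iff (hQ : Function.Injective Q) :
    α ∈ C.Hhat Q ↔ ∃ h ∈ C.riemannRochSpace (C.Dt Q α), h ≠ 0 ∧
      ∀ i, h ∉ C.riemannRochSpace (C.Dt Q α - Finsupp.single (Q i) 1) := by
  constructor
  · rintro ⟨h, hh0, hout, hα⟩
    have hh := (C.mem_riemannRochSpace_Dt_iff α hQ hh0).2 ⟨hout, fun i => (hα i).ge⟩
    refine ⟨h, hh, hh0, fun i => ?_⟩
    rw [C.mem_riemannRochSpace_sub_single_iff hh hh0, C.Dt_apply α hQ, not_not]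
    exact hα i
  · rintro ⟨h, hh, hh0, hα⟩
    refine ⟨h, hh0, ((C.mem_riemannRochSpace_Dt_iff α hQ hh0).1 hh).1, fun i => ?_⟩
    have := hα i
    rwa [C.mem_riemannRochSpace_sub_single_iff hh hh0, C.Dt_apply α hQ, not_not] at this

theorem nablaI_eq_empty_iff (hQ : Function.Injective Q) (i : Fin m) :
    C.nablaI Q i α = ∅ ↔ C.riemannRochSpace (C.Dt Q α) ≤
      C.riemannRochSpace (C.Dt Q α - Finsupp.single (Q i) 1) := by
  rw [Set.eq_empty_iff_forall_notMem]
  constructor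
  · intro hempty h hh
    rcases eq_or_ne h 0 with rfl | hh0
    · exact zero_mem _
    rw [C.mem_riemannRochSpace_sub_single_iff hh hh0, C.Dt_apply α hQ]
    intro hi
    have hD := (C.mem_riemannRochSpace_Dt_iff α hQ hh0).1 hh
    exact hempty (fun j => -C.v (Q j) h) ⟨⟨h, hh0, hD.1, fun _ => rfl⟩, hi.symm, fun j _ => hD.2 j⟩
  · rintro hle β ⟨⟨h, hh0, hout, hβ⟩, hi, hj⟩
    have hh : h ∈ C.riemannRochSpace (C.Dt Q α) := by
      refine (C.mem_riemannRochSpace_Dt_iff α hQ hh0).2 ⟨hout, fun j => ?_⟩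
      rw [← hβ j]
      rcases eq_or_ne j i with rfl | hji
      · exact hi.le
      · exact hj j hji
    have := (C.mem_riemannRochSpace_sub_single_iff hh hh0).1 (hle hh)
    rw [C.Dt_apply α hQ] at this
    exact this (hi.symm.trans (hβ i))

end Dt

end Curve

/-- Proposition 2.1: assume `q ≥ m` and let `α ∈ ℤ^m`.  Then
(1) `α ∈ Ĥ(Q)` iff `ℓ(D_α) = ℓ(D_α - Q_i) + 1` for all `i`; and
(2) for each `i`, `∇_i^m(α) = ∅` iff `ℓ(D_α) = ℓ(D_α - Q_i)`. -/
theorem statement16 {Fq : Type} [Field Fq] [Fintype Fq] (C : Curve Fq)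
    (hgenus : 0 < C.genus) (K₀ : C.Point →₀ ℤ)
    (hRR : ∀ D : C.Point →₀ ℤ,
      (C.ell D : ℤ) - C.ell (K₀ - D) = C.degDiv D + 1 - C.genus)
    {m : ℕ} (hm : 2 ≤ m) (Q : Fin m → C.Point)
    (hQinj : Function.Injective Q) (hQdeg : ∀ i, C.deg (Q i) = 1)
    (hq : m ≤ Fintype.card Fq) (α : Fin m → ℤ) :
    (α ∈ C.Hhat Q ↔ ∀ i : Fin m,
        C.ell (C.Dt Q α) = C.ell (C.Dt Q α - Finsupp.single (Q i) 1) + 1) ∧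
      ∀ i : Fin m, (C.nablaI Q i α = ∅ ↔
        C.ell (C.Dt Q α) = C.ell (C.Dt Q α - Finsupp.single (Q i) 1)) := by
  simp only [Curve.ell_eq_ell_sub_single_add_one_iff hRR (hQdeg _),
    Curve.ell_eq_ell_sub_single_iff hRR]
  refine ⟨?_, fun i => C.nablaI_eq_empty_iff α hQinj i⟩
  rw [C.mem_Hhat_iff α hQinj]
  constructor
  · rintro ⟨h, hh, -, hα⟩ i hle
    exact hα i (hle hh)
  · intro hα
    have i₀ : Fin m := ⟨0, by omega⟩
    have := Curve.finiteDimensional_riemannRochSpace hRR (Q i₀) (C.Dt Q α)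
    obtain ⟨h, hh, hh'⟩ := Submodule.exists_mem_forall_notMem_of_card_le
      (W := C.riemannRochSpace (C.Dt Q α))
      (fun i => lt_of_le_not_ge (C.riemannRochSpace_mono
        (sub_le_self _ (Finsupp.single_nonneg.2 zero_le_one))) (hα i)) (by simpa using hq)
    refine ⟨h, hh, ?_, hh'⟩
    rintro rfl
    exact hh' i₀ (zero_mem _)
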